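/- Let ω be a radial weight in \hat{𝒟}. Then the asymptotic equality ∫_0^1 s^x ω(s) ds ≍ \hat{ω}(1 - 1/x) holds for x ∈ [1,∞); that is, there exist constants c, C > 0 depending only on ω such that c·\hat{ω}(1-1/x) ≤ ∫_0^1 s^x ω(s)ds ≤ C·\hat{ω}(1-1/x) for all x ≥ 1. -/

import Mathlib

open MeasureTheory Set

/-- The tail integral of an a.e. nonnegative integrable weight is antitone. -/
lemma tail_antitone {ω : ℝ → ℝ} (hae : ∀ᵐ s, s ∈ Ioc (0:ℝ) 1 → 0 ≤ ω s)
    (hint : IntegrableOn ω (Ioc (0:ℝ) 1)) {a b : ℝ} (ha : 0 ≤ a) (hab : a ≤ b) :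
    (∫ s in Ioc b 1, ω s) ≤ ∫ s in Ioc a 1, ω s := by
  refine setIntegral_mono_set (hint.mono_set (Ioc_subset_Ioc_left ha)) ?_
    (Ioc_subset_Ioc_left hab).eventuallyLE
  refine (ae_restrict_iff' measurableSet_Ioc).2 ?_
  filter_upwards [hae] with s hs hsa using hs (Ioc_subset_Ioc_left ha hsa)

lemma integrableOn_rpow_mul {ω : ℝ → ℝ} (hint : IntegrableOn ω (Ioc (0:ℝ) 1))
    {x : ℝ} (hx : 0 ≤ x) : IntegrableOn (fun s => s ^ x * ω s) (Ioc (0:ℝ) 1) := by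
  refine Integrable.bdd_mul (c := 1) hint
    (Real.continuous_rpow_const hx).aestronglyMeasurable ?_
  refine (ae_restrict_iff' measurableSet_Ioc).2 (ae_of_all _ fun s hs => ?_)
  rw [Real.norm_of_nonneg (Real.rpow_nonneg hs.1.le x)]
  exact Real.rpow_le_one hs.1.le hs.2 hx

/-- `exp (-2 ^ n)` beats every geometric growth. -/
lemma exists_exp_neg_two_pow_mul_pow_le {C : ℝ} (hC : 0 ≤ C) :
    ∃ A > 0, ∀ n : ℕ, Real.exp (-2 ^ n) * C ^ (n + 1) ≤ A * (1 / 2) ^ n := by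
  obtain ⟨m, hm⟩ := pow_unbounded_of_one_lt (2 * C) (one_lt_two : (1:ℝ) < 2)
  refine ⟨(C + 1) * m.factorial, by positivity, fun n => ?_⟩
  have h1 : ((2:ℝ) ^ n) ^ m / m.factorial ≤ Real.exp (2 ^ n) :=
    Real.pow_div_factorial_le_exp _ (by positivity) m
  have h2 : (2 * C) ^ n ≤ ((2:ℝ) ^ n) ^ m := by
    rw [← pow_mul, mul_comm n m, pow_mul]
    exact pow_le_pow_left₀ (by positivity) hm.le n
  have h3 : (2:ℝ) ^ n * C ^ n ≤ m.factorial * Real.exp (2 ^ n) := by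
    rw [← mul_pow]
    rw [div_le_iff₀ (by positivity)] at h1
    linarith
  rw [Real.exp_neg, inv_mul_le_iff₀ (Real.exp_pos _), one_div, inv_pow]
  have h4 : C ^ n ≤ m.factorial * Real.exp (2 ^ n) * ((2:ℝ) ^ n)⁻¹ := by
    rw [← div_eq_mul_inv, le_div_iff₀ (by positivity)]
    linarith
  calc C ^ (n + 1) = C * C ^ n := pow_succ' C n
    _ ≤ (C + 1) * (m.factorial * Real.exp (2 ^ n) * ((2:ℝ) ^ n)⁻¹) := by
        gcongr
        linarith
    _ = _ := by ring

/-- For `ω ∈ 𝒟̂`, one has `∫_0^1 s^x ω(s) ds ≍ ω̂(1 - 1/x)` for `x ∈ [1,∞)`. -/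
theorem stmt_2 (ω : ℝ → ℝ)
    (hnn : ∀ r ∈ Set.Ico (0:ℝ) 1, 0 ≤ ω r)
    (hint : MeasureTheory.IntegrableOn ω (Set.Ioc (0:ℝ) 1))
    (hpos : ∀ r ∈ Set.Ico (0:ℝ) 1, 0 < ∫ s in Set.Ioc r 1, ω s)
    (hD : ∃ C : ℝ, 1 ≤ C ∧ ∀ r ∈ Set.Ico (0:ℝ) 1,
      (∫ s in Set.Ioc r 1, ω s) ≤ C * ∫ s in Set.Ioc ((1 + r) / 2) 1, ω s) :
    ∃ c > (0:ℝ), ∃ C > (0:ℝ), ∀ x : ℝ, 1 ≤ x →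
      c * (∫ s in Set.Ioc (1 - 1/x) 1, ω s) ≤
          (∫ s in Set.Ioc (0:ℝ) 1, s ^ x * ω s) ∧
        (∫ s in Set.Ioc (0:ℝ) 1, s ^ x * ω s) ≤
          C * ∫ s in Set.Ioc (1 - 1/x) 1, ω s := by
  obtain ⟨C, hC1, hC⟩ := hD
  have hC0 : 0 < C := by linarith
  obtain ⟨A, hA, hAn⟩ := exists_exp_neg_two_pow_mul_pow_le hC0.le
  have hae : ∀ᵐ s, s ∈ Ioc (0:ℝ) 1 → 0 ≤ ω s := by
    filter_upwards [Measure.ae_ne volume (1:ℝ)] with s hs1 hs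
    exact hnn s ⟨hs.1.le, lt_of_le_of_ne hs.2 hs1⟩
  refine ⟨1 / (2 * C), by positivity, 1 + 2 * A, by positivity, fun x hx => ?_⟩
  have hx0 : 0 < x := by linarith
  have hinv : 1 / x ≤ 1 := by rw [div_le_one hx0]; exact hx
  have hinv0 : 0 < 1 / x := by positivity
  have hxint := integrableOn_rpow_mul hint hx0.le
  have hH : 0 < ∫ s in Ioc (1 - 1/x) 1, ω s := hpos _ ⟨by linarith, by linarith⟩
  constructor
  · set r := (1 + (1 - 1/x)) / 2 with hr
    have hr0 : 0 ≤ r := by linarith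
    have hd : (∫ s in Ioc (1 - 1/x) 1, ω s) ≤ C * ∫ s in Ioc r 1, ω s :=
      hC _ ⟨by linarith, by linarith⟩
    have hrx : 1 / 2 ≤ r ^ x := by
      have := one_add_mul_self_le_rpow_one_add (s := -(1 / x) / 2) (by linarith) hx
      have e1 : 1 + x * (-(1 / x) / 2) = 1 / 2 := by field_simp; norm_num
      have e2 : 1 + -(1 / x) / 2 = r := by rw [hr]; ring
      rwa [e1, e2] at this
    have h1 : (∫ s in Ioc r 1, (1 / 2) * ω s) ≤ ∫ s in Ioc r 1, s ^ x * ω s := by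
      refine setIntegral_mono_on_ae
        ((hint.mono_set (Ioc_subset_Ioc_left hr0)).const_mul _)
        (hxint.mono_set (Ioc_subset_Ioc_left hr0)) measurableSet_Ioc ?_
      filter_upwards [hae] with s hs hsr
      exact mul_le_mul_of_nonneg_right
        (hrx.trans (Real.rpow_le_rpow hr0 hsr.1.le hx0.le))
        (hs (Ioc_subset_Ioc_left hr0 hsr))
    have h2 : (∫ s in Ioc r 1, s ^ x * ω s) ≤ ∫ s in Ioc (0:ℝ) 1, s ^ x * ω s := by
      refine tail_antitone ?_ hxint le_rfl hr0
      filter_upwards [hae] with s hs hs0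
      exact mul_nonneg (Real.rpow_nonneg hs0.1.le x) (hs hs0)
    rw [integral_const_mul] at h1
    calc 1 / (2 * C) * (∫ s in Ioc (1 - 1/x) 1, ω s)
        ≤ 1 / (2 * C) * (C * ∫ s in Ioc r 1, ω s) := by gcongr
      _ = 1 / 2 * ∫ s in Ioc r 1, ω s := by field_simp
      _ ≤ _ := h1.trans h2
  · set H := ∫ s in Ioc (1 - 1/x) 1, ω s with hHdef
    let r : ℕ → ℝ := fun n => max 0 (1 - 2 ^ n / x)
    have hr0 : ∀ n, 0 ≤ r n := fun n => le_max_left _ _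
    have hr1 : ∀ n, r n < 1 := fun n =>
      max_lt one_pos (by have : (0:ℝ) < 2 ^ n / x := by positivity
                         linarith)
    have hrz : r 0 = 1 - 1 / x := by
      simp only [r, pow_zero]
      exact max_eq_right (by linarith)
    have hrs : ∀ n, r (n + 1) ≤ r n := fun n => by
      refine max_le_max le_rfl (sub_le_sub_left ?_ 1)
      gcongr
      · norm_num
      · omega
    have htail : ∀ n, (∫ s in Ioc (r n) 1, ω s) ≤ C ^ n * H := by
      intro n
      induction n with
      | zero => rw [hrz, pow_zero, one_mul]
      | succ n ih =>
        have hle : r n ≤ (1 + r (n + 1)) / 2 := by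
          have h1 : 1 - 2 ^ (n + 1) / x ≤ r (n + 1) := le_max_right _ _
          have h2 : (2:ℝ) ^ (n + 1) / x = 2 * (2 ^ n / x) := by ring
          have h3 := hr0 (n + 1)
          exact max_le (by linarith) (by linarith)
        calc (∫ s in Ioc (r (n + 1)) 1, ω s)
            ≤ C * ∫ s in Ioc ((1 + r (n + 1)) / 2) 1, ω s := hC _ ⟨hr0 _, hr1 _⟩
          _ ≤ C * (C ^ n * H) := by
              gcongr
              exact (tail_antitone hae hint (hr0 n) hle).trans ih
          _ = C ^ (n + 1) * H := by ring
    have hmain : ∀ n, (∫ s in Ioc (r n) 1, s ^ x * ω s) ≤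
        (1 + 2 * A - 2 * A * (1 / 2) ^ n) * H := by
      intro n
      induction n with
      | zero =>
        rw [hrz, pow_zero]
        have hs0 : Ioc (1 - 1/x) 1 ⊆ Ioc 0 1 := Ioc_subset_Ioc_left (by linarith)
        have : (∫ s in Ioc (1 - 1/x) 1, s ^ x * ω s) ≤ H := by
          refine setIntegral_mono_on_ae (hxint.mono_set hs0) (hint.mono_set hs0)
            measurableSet_Ioc ?_
          filter_upwards [hae] with s hs hsr
          exact mul_le_of_le_one_left (hs (hs0 hsr))
            (Real.rpow_le_one (hs0 hsr).1.le hsr.2 hx0.le)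
        linarith
      | succ n ih =>
        have hs1 : Ioc (r (n + 1)) 1 ⊆ Ioc 0 1 := Ioc_subset_Ioc_left (hr0 _)
        have hs2 : Ioc (r (n + 1)) (r n) ⊆ Ioc (r (n + 1)) 1 :=
          Ioc_subset_Ioc_right (hr1 n).le
        have hs3 : Ioc (r n) 1 ⊆ Ioc 0 1 := Ioc_subset_Ioc_left (hr0 _)
        have hsplit : (∫ s in Ioc (r (n + 1)) 1, s ^ x * ω s) =
            (∫ s in Ioc (r (n + 1)) (r n), s ^ x * ω s) +
              ∫ s in Ioc (r n) 1, s ^ x * ω s := by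
          rw [← Ioc_union_Ioc_eq_Ioc (hrs n) (hr1 n).le]
          exact setIntegral_union (Ioc_disjoint_Ioc_of_le le_rfl) measurableSet_Ioc
            (hxint.mono_set (hs2.trans hs1)) (hxint.mono_set hs3)
        have hpiece : (∫ s in Ioc (r (n + 1)) (r n), s ^ x * ω s) ≤
            ∫ s in Ioc (r (n + 1)) (r n), Real.exp (-2 ^ n) * ω s := by
          refine setIntegral_mono_on_ae (hxint.mono_set (hs2.trans hs1))
            ((hint.mono_set (hs2.trans hs1)).const_mul _) measurableSet_Ioc ?_
          filter_upwards [hae] with s hs hsr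
          have hsI := hs1 (hs2 hsr)
          refine mul_le_mul_of_nonneg_right ?_ (hs hsI)
          have hsn : s ≤ 1 - 2 ^ n / x := (le_max_iff.1 hsr.2).resolve_left hsI.1.not_ge
          rw [Real.rpow_def_of_pos hsI.1]
          refine Real.exp_le_exp.2 ?_
          have hlog : Real.log s ≤ -(2 ^ n / x) := by
            linarith [Real.log_le_sub_one_of_pos hsI.1]
          calc Real.log s * x ≤ -(2 ^ n / x) * x := by gcongr
            _ = -2 ^ n := by field_simp
        have hmono : (∫ s in Ioc (r (n + 1)) (r n), ω s) ≤
            ∫ s in Ioc (r (n + 1)) 1, ω s := by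
          refine setIntegral_mono_set (hint.mono_set hs1) ?_ hs2.eventuallyLE
          refine (ae_restrict_iff' measurableSet_Ioc).2 ?_
          filter_upwards [hae] with s hs hsa using hs (hs1 hsa)
        rw [integral_const_mul] at hpiece
        have hexp : Real.exp (-2 ^ n) * (∫ s in Ioc (r (n + 1)) (r n), ω s) ≤
            A * (1 / 2) ^ n * H := by
          calc Real.exp (-2 ^ n) * (∫ s in Ioc (r (n + 1)) (r n), ω s)
              ≤ Real.exp (-2 ^ n) * (C ^ (n + 1) * H) := by
                gcongr
                exact hmono.trans (htail (n + 1))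
            _ = Real.exp (-2 ^ n) * C ^ (n + 1) * H := by ring
            _ ≤ _ := mul_le_mul_of_nonneg_right (hAn n) hH.le
        have e : (1 + 2 * A - 2 * A * (1 / 2) ^ (n + 1)) * H =
            A * (1 / 2) ^ n * H + (1 + 2 * A - 2 * A * (1 / 2) ^ n) * H := by ring
        rw [hsplit, e]
        linarith
    obtain ⟨N, hN⟩ := pow_unbounded_of_one_lt x (one_lt_two : (1:ℝ) < 2)
    have hrN : r N = 0 := by
      refine max_eq_left ?_
      have : 1 ≤ 2 ^ N / x := by rw [le_div_iff₀ hx0]; linarith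
      linarith
    have hfin := hmain N
    rw [hrN] at hfin
    refine hfin.trans (mul_le_mul_of_nonneg_right ?_ hH.le)
    have : 0 ≤ 2 * A * (1 / 2) ^ N := by positivity
    linarith
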